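/- arXiv:2407.07975 — 2 statements merged into one kernel-verified Lean document; each statement's English description precedes it below -/
import Mathlib

section
/- Let (W,S) be a Coxeter system with set of reflections T, and let φ : W → Sym(n) be an injective group homomorphism for some positive integer n. Then the following are equivalent: (i) φ is a strong E-embedding; (ii) for all w ∈ W and all t ∈ T with w <_B w·t in the Bruhat order of W, and for every non-fixed point a of φ(t), one has φ(w) <_B φ(w)·(a, φ(t)(a)) in the Bruhat order of Sym(n). -/
open Equiv

/-- The inversion number of a permutation of `Fin n`. -/
def permInvNum {n : ℕ} (σ : Equiv.Perm (Fin n)) : ℕ :=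
  (Finset.univ.filter (fun p : Fin n × Fin n => p.1 < p.2 ∧ σ p.2 < σ p.1)).card

/-- The strict Bruhat order on the symmetric group `Sym(n)`. -/
def permBruhatLT {n : ℕ} : Equiv.Perm (Fin n) → Equiv.Perm (Fin n) → Prop :=
  Relation.TransGen (fun a b => ∃ t : Equiv.Perm (Fin n), t.IsSwap ∧ b = a * t ∧
    permInvNum a < permInvNum b)

/-- The strict Bruhat order on a Coxeter group: the transitive closure of the covering
relations `w < w·t` for `t` a reflection with `ℓ(wt) > ℓ(w)`. -/
def coxBruhatLT {B W : Type*} [Group W] {M : CoxeterMatrix B} (cs : CoxeterSystem M W) :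
    W → W → Prop :=
  Relation.TransGen (fun u v => ∃ t : W, cs.IsReflection t ∧ v = u * t ∧
    cs.length u < cs.length v)

/-- The condition defining strong E-embeddings. -/
def StrongECond {B W : Type*} [Group W] {M : CoxeterMatrix B} (cs : CoxeterSystem M W)
    {n : ℕ} (φ : W →* Equiv.Perm (Fin n)) : Prop :=
  ∀ (w : W) (i : B), cs.length (w * cs.simple i) = cs.length w + 1 →
    ∀ a : Fin n, φ (cs.simple i) a ≠ a →
      permBruhatLT (φ w) (φ w * Equiv.swap a (φ (cs.simple i) a))

/-! ### The Bruhat order on the symmetric group -/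

theorem permInvNum_lt_mul_swap {n : ℕ} {σ : Equiv.Perm (Fin n)} {a b : Fin n} (hab : a < b)
    (hσ : σ a < σ b) : permInvNum σ < permInvNum (σ * Equiv.swap a b) := by
  classical
  let τ := Equiv.swap a b
  let f : Fin n × Fin n → Fin n × Fin n := fun p =>
    if τ p.1 < τ p.2 then (τ p.1, τ p.2) else p
  have hττ : ∀ x, τ (τ x) = x := fun x => Equiv.swap_apply_self a b x
  unfold permInvNum
  rw [← Finset.card_image_of_injOn (f := f)]
  · apply Finset.card_lt_card
    rw [Finset.ssubset_iff_of_subset]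
    · refine ⟨(a, b), ?_, ?_⟩
      · rw [Finset.mem_filter]
        simp [hab, hσ]
      · simp only [Finset.mem_image, Finset.mem_filter, Finset.mem_univ, true_and, not_exists,
          not_and, Prod.forall]
        rintro i j ⟨hij, hσij⟩ h
        by_cases hc : τ i < τ j
        · simp only [f, if_pos hc, Prod.mk.injEq] at h
          have hi : i = b := by rw [← hττ i, h.1]; exact Equiv.swap_apply_left a b
          have hj : j = a := by rw [← hττ j, h.2]; exact Equiv.swap_apply_right a b
          subst hi hj
          exact absurd hij hab.asymm
        · simp only [f, if_neg hc, Prod.mk.injEq] at h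
          obtain ⟨rfl, rfl⟩ := h
          exact absurd hσij hσ.asymm
    · intro q hq
      simp only [Finset.mem_image, Finset.mem_filter, Finset.mem_univ, true_and,
        Prod.exists] at hq ⊢
      obtain ⟨i, j, ⟨hij, hσij⟩, rfl⟩ := hq
      by_cases hc : τ i < τ j
      · simp only [f, if_pos hc, Equiv.Perm.mul_apply]
        exact ⟨hc, by simpa [τ] using hσij⟩
      · simp only [f, if_neg hc, Equiv.Perm.mul_apply]
        refine ⟨hij, ?_⟩
        simp only [τ, Equiv.swap_apply_def] at hc ⊢
        grind
  · rintro ⟨i, j⟩ hp ⟨k, l⟩ hq h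
    simp only [Finset.coe_filter, Finset.mem_univ, true_and, Set.mem_ofPred_eq] at hp hq
    have hinj := τ.injective
    simp only [f] at h
    grind [Function.Injective]

/-- Right multiplication by the transposition `(a b)` ascends in the Bruhat order exactly when
the permutation preserves the relative order of `a` and `b`. -/
theorem permBruhatLT_mul_swap_iff {n : ℕ} (σ : Equiv.Perm (Fin n)) {a b : Fin n} (hab : a ≠ b) :
    permBruhatLT σ (σ * Equiv.swap a b) ↔ (a < b ↔ σ a < σ b) := by
  wlog h : a < b generalizing a b
  · have hba : b < a := lt_of_le_of_ne (not_lt.mp h) hab.symm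
    rw [Equiv.swap_comm, this hab.symm hba]
    have : σ a ≠ σ b := σ.injective.ne hab
    grind
  simp only [h, true_iff]
  constructor
  · intro hB
    have hlt : permInvNum σ < permInvNum (σ * Equiv.swap a b) := by
      refine Relation.TransGen.trans_induction_on (motive := fun {x y} _ =>
        permInvNum x < permInvNum y) hB ?_ ?_
      · rintro x y ⟨t, -, -, hxy⟩
        exact hxy
      · intro x y z _ _ hxy hyz
        exact hxy.trans hyz
    by_contra hσ
    have hσ' : σ b < σ a := lt_of_le_of_ne (not_lt.mp hσ) (σ.injective.ne hab.symm)
    have := permInvNum_lt_mul_swap (σ := σ * Equiv.swap a b) h (by simpa using hσ')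
    rw [mul_assoc, Equiv.swap_mul_self, mul_one] at this
    exact hlt.asymm this
  · intro hσ
    exact .single ⟨_, Equiv.Perm.swap_isSwap_iff.mpr hab, rfl, permInvNum_lt_mul_swap h hσ⟩

/-! ### The reflection cocycle of a Coxeter system -/

namespace CoxeterSystem

variable {B W : Type*} [Group W] {M : CoxeterMatrix B} (cs : CoxeterSystem M W)

theorem length_lt_of_coxBruhatLT {u v : W} (h : coxBruhatLT cs u v) :
    cs.length u < cs.length v := by
  refine Relation.TransGen.trans_induction_on (motive := fun {x y} _ =>
    cs.length x < cs.length y) h ?_ ?_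
  · rintro x y ⟨t, -, -, hxy⟩
    exact hxy
  · intro x y z _ _ hxy hyz
    exact hxy.trans hyz

open Classical in
/-- The action of a simple reflection on signed group elements: conjugation, together with a sign
change on the simple reflection itself. -/
noncomputable def signedConjSimple (i : B) : Function.End (W × ZMod 2) := fun p =>
  (cs.simple i * p.1 * cs.simple i, p.2 + if p.1 = cs.simple i then 1 else 0)

open Classical in
theorem signedConjSimple_mul_pow_apply (i j : B) (m : ℕ) (t : W) (ε : ZMod 2) :
    ((cs.signedConjSimple i * cs.signedConjSimple j) ^ m) (t, ε) =
      ((cs.simple i * cs.simple j) ^ m * t * ((cs.simple i * cs.simple j) ^ m)⁻¹,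
        ε + ∑ l ∈ Finset.range (2 * m),
          if (cs.simple i * cs.simple j) ^ l * t = cs.simple j then 1 else 0) := by
  have hsemi : SemiconjBy (cs.simple j) (cs.simple i * cs.simple j)
      (cs.simple i * cs.simple j)⁻¹ := by
    simp [SemiconjBy, mul_assoc]
  induction m with
  | zero => simp; rfl
  | succ m ih =>
    rw [pow_succ']
    change (cs.signedConjSimple i * cs.signedConjSimple j)
      (((cs.signedConjSimple i * cs.signedConjSimple j) ^ m) (t, ε)) = _
    rw [ih]
    change cs.signedConjSimple i (cs.signedConjSimple j _) = _
    have hpow : cs.simple j * (cs.simple i * cs.simple j) ^ m =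
        ((cs.simple i * cs.simple j) ^ m)⁻¹ * cs.simple j := by
      simpa only [inv_pow] using (hsemi.pow_right m).eq
    have heven : (cs.simple i * cs.simple j) ^ m * t * ((cs.simple i * cs.simple j) ^ m)⁻¹ =
        cs.simple j ↔ (cs.simple i * cs.simple j) ^ (2 * m) * t = cs.simple j := by
      rw [mul_inv_eq_iff_eq_mul, hpow, eq_inv_mul_iff_mul_eq, two_mul, pow_add, mul_assoc]
    have hodd : cs.simple j * ((cs.simple i * cs.simple j) ^ m * t *
        ((cs.simple i * cs.simple j) ^ m)⁻¹) * cs.simple j = cs.simple i ↔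
        (cs.simple i * cs.simple j) ^ (2 * m + 1) * t = cs.simple j := by
      have hconj : ∀ x, cs.simple j * x * cs.simple j = cs.simple i ↔
          (cs.simple i * cs.simple j) * x = cs.simple j := by
        intro x
        constructor
        · intro h
          have hx : x = cs.simple j * cs.simple i * cs.simple j := by
            rw [← h]
            simp [mul_assoc]
          simp [hx, mul_assoc]
        · intro h
          have hx : x = cs.simple j * (cs.simple i * (cs.simple i * cs.simple j * x)) := by
            simp [mul_assoc]
          rw [hx, h]
          simp [mul_assoc]
      rw [hconj, ← mul_assoc, mul_inv_eq_iff_eq_mul, hpow, eq_inv_mul_iff_mul_eq, pow_succ',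
        two_mul, pow_add]
      simp only [← mul_assoc, (Commute.pow_self (cs.simple i * cs.simple j) m).eq]
    rw [show 2 * (m + 1) = 2 * m + 1 + 1 by ring, Finset.sum_range_succ, Finset.sum_range_succ]
    simp only [signedConjSimple, heven, hodd, add_assoc]
    simp [pow_succ', mul_assoc]

theorem isLiftable_signedConjSimple : M.IsLiftable cs.signedConjSimple := by
  classical
  intro i j
  funext ⟨t, ε⟩
  rw [signedConjSimple_mul_pow_apply, two_mul, Finset.sum_range_add]
  simp only [pow_add, cs.simple_mul_simple_pow, one_mul, inv_one, mul_one, CharTwo.add_self_eq_zero,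
    add_zero]
  rfl

/-- The action of a Coxeter group on signed group elements. -/
noncomputable def signedConj : W →* Function.End (W × ZMod 2) :=
  cs.lift ⟨cs.signedConjSimple, cs.isLiftable_signedConjSimple⟩

open Classical in
theorem signedConj_wordProd (ω : List B) (t : W) (ε : ZMod 2) :
    cs.signedConj (cs.wordProd ω) (t, ε) =
      (cs.wordProd ω * t * (cs.wordProd ω)⁻¹, ε + ((cs.rightInvSeq ω).count t : ZMod 2)) := by
  induction ω with
  | nil => simp; rfl
  | cons i ω ih =>
    have hcond : cs.wordProd ω * t * (cs.wordProd ω)⁻¹ = cs.simple i ↔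
        (cs.wordProd ω)⁻¹ * cs.simple i * cs.wordProd ω = t := by
      constructor
      · intro h; rw [← h]; group
      · intro h; rw [← h]; group
    rw [wordProd_cons, map_mul]
    change cs.signedConj (cs.simple i) (cs.signedConj (cs.wordProd ω) (t, ε)) = _
    rw [ih, signedConj, lift_apply_simple]
    simp only [signedConjSimple, rightInvSeq, List.count_cons, hcond, beq_iff_eq, Nat.cast_add,
      Nat.cast_ite, Nat.cast_one, Nat.cast_zero, add_assoc, mul_inv_rev, inv_simple]
    simp only [mul_assoc]

/-- The reflection cocycle: the parity of the number of occurrences of `t` in the right inversion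
sequence of a word representing `w`. -/
noncomputable def reflCocycle (w t : W) : ZMod 2 := (cs.signedConj w (t, 0)).2

open Classical in
theorem reflCocycle_wordProd (ω : List B) (t : W) :
    cs.reflCocycle (cs.wordProd ω) t = ((cs.rightInvSeq ω).count t : ZMod 2) := by
  simp [reflCocycle, signedConj_wordProd]

theorem signedConj_apply (w t : W) (ε : ZMod 2) :
    cs.signedConj w (t, ε) = (w * t * w⁻¹, ε + cs.reflCocycle w t) := by
  classical
  obtain ⟨ω, rfl⟩ := cs.wordProd_surjective w
  rw [signedConj_wordProd, reflCocycle_wordProd]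

theorem reflCocycle_mul (u v t : W) :
    cs.reflCocycle (u * v) t = cs.reflCocycle v t + cs.reflCocycle u (v * t * v⁻¹) := by
  rw [reflCocycle, map_mul]
  change (cs.signedConj u (cs.signedConj v (t, 0))).2 = _
  rw [signedConj_apply, signedConj_apply, zero_add]

theorem reflCocycle_one (t : W) : cs.reflCocycle 1 t = 0 := by
  simpa using cs.reflCocycle_wordProd [] t

theorem reflCocycle_simple_self (i : B) : cs.reflCocycle (cs.simple i) (cs.simple i) = 1 := by
  simpa using cs.reflCocycle_wordProd [i] (cs.simple i)

theorem IsReflection.reflCocycle_self {cs : CoxeterSystem M W} {t : W} (ht : cs.IsReflection t) :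
    cs.reflCocycle t t = 1 := by
  obtain ⟨u, i, rfl⟩ := ht
  have h := cs.reflCocycle_mul u u⁻¹ (u * cs.simple i * u⁻¹)
  have hconj : u⁻¹ * (u * cs.simple i * u⁻¹) * u⁻¹⁻¹ = cs.simple i := by group
  rw [mul_inv_cancel, reflCocycle_one, hconj] at h
  rw [reflCocycle_mul, hconj, reflCocycle_mul, reflCocycle_simple_self]
  simp only [inv_simple, simple_mul_simple_self, one_mul]
  rw [add_left_comm, ← h, add_zero]

theorem length_mul_lt_of_reflCocycle_ne_zero {w t : W} (h : cs.reflCocycle w t ≠ 0) :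
    cs.length (w * t) < cs.length w := by
  classical
  obtain ⟨ω, hω, rfl⟩ := cs.exists_isReduced w
  refine (cs.isRightInversion_of_mem_rightInvSeq hω ?_).2
  by_contra hmem
  exact h (by rw [reflCocycle_wordProd, List.count_eq_zero_of_not_mem hmem, Nat.cast_zero])

/-- A reflection `t` lengthens `w` exactly when the reflection cocycle vanishes at `(w, t)`. -/
theorem length_lt_length_mul_iff {w t : W} (ht : cs.IsReflection t) :
    cs.length w < cs.length (w * t) ↔ cs.reflCocycle w t = 0 := by
  constructor
  · intro h
    by_contra hne
    exact h.asymm (cs.length_mul_lt_of_reflCocycle_ne_zero hne)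
  · intro h
    have hne : cs.reflCocycle (w * t) t ≠ 0 := by
      rw [reflCocycle_mul, ht.reflCocycle_self, mul_inv_cancel_right, h]
      decide
    simpa [mul_assoc, ht.mul_self] using cs.length_mul_lt_of_reflCocycle_ne_zero hne

/-- If the reflection `u s u⁻¹` lengthens `w`, then the simple reflection `s` lengthens `w u`
exactly when it lengthens `u`. -/
theorem length_lt_length_mul_simple_iff {w u : W} {i : B}
    (h : cs.length w < cs.length (w * (u * cs.simple i * u⁻¹))) :
    cs.length (w * u) < cs.length (w * u * cs.simple i) ↔
      cs.length u < cs.length (u * cs.simple i) := by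
  have hs := cs.isReflection_simple i
  rw [cs.length_lt_length_mul_iff (hs.conj u)] at h
  rw [cs.length_lt_length_mul_iff hs, cs.length_lt_length_mul_iff hs, reflCocycle_mul, h, add_zero]

end CoxeterSystem

/-- For a strong E-embedding, a simple reflection `s` lengthens `w` exactly when `φ w` preserves
the relative order within each (equivalently, some) two-cycle of `φ s`. -/
theorem StrongECond.length_lt_iff {B W : Type*} [Group W] {M : CoxeterMatrix B}
    {cs : CoxeterSystem M W} {n : ℕ} {φ : W →* Equiv.Perm (Fin n)} (hφ : StrongECond cs φ)
    (w : W) (i : B) {a : Fin n} (ha : φ (cs.simple i) a ≠ a) :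
    cs.length w < cs.length (w * cs.simple i) ↔
      (a < φ (cs.simple i) a ↔ φ w a < φ w (φ (cs.simple i) a)) := by
  rcases cs.length_mul_simple w i with h | h
  · have := hφ w i h a ha
    rw [permBruhatLT_mul_swap_iff _ ha.symm] at this
    simp only [this, iff_true]
    lia
  · have h' : cs.length (w * cs.simple i * cs.simple i) = cs.length (w * cs.simple i) + 1 := by
      rw [cs.simple_mul_simple_cancel_right]
      exact h.symm
    have := hφ _ i h' a ha
    have hs : φ (cs.simple i) (φ (cs.simple i) a) = a := by
      rw [← Equiv.Perm.mul_apply, ← map_mul, cs.simple_mul_simple_self, map_one,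
        Equiv.Perm.one_apply]
    rw [permBruhatLT_mul_swap_iff _ ha.symm, map_mul, Equiv.Perm.mul_apply, Equiv.Perm.mul_apply,
      hs] at this
    have hne : φ w a ≠ φ w (φ (cs.simple i) a) := (φ w).injective.ne ha.symm
    have hlt : ¬ cs.length w < cs.length (w * cs.simple i) := by lia
    simp only [hlt, false_iff, this]
    grind

theorem stmt2 {B W : Type*} [Group W] {M : CoxeterMatrix B} (cs : CoxeterSystem M W)
    {n : ℕ} (hn : 0 < n) (φ : W →* Equiv.Perm (Fin n))
    (hinj : Function.Injective φ) :
    StrongECond cs φ ↔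
      (∀ (w t : W), cs.IsReflection t → coxBruhatLT cs w (w * t) →
        ∀ a : Fin n, φ t a ≠ a →
          permBruhatLT (φ w) (φ w * Equiv.swap a (φ t a))) := by
  constructor
  · rintro hφ w _ ⟨u, i, rfl⟩ hw a ha
    obtain ⟨c, rfl⟩ := (φ u).surjective a
    have hua : φ (u * cs.simple i * u⁻¹) (φ u c) = φ u (φ (cs.simple i) c) := by
      simp
    rw [hua] at ha ⊢
    have hc : φ (cs.simple i) c ≠ c := fun h => ha (by rw [h])
    have key := cs.length_lt_length_mul_simple_iff (cs.length_lt_of_coxBruhatLT hw)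
    rw [hφ.length_lt_iff _ _ hc, hφ.length_lt_iff _ _ hc, map_mul, Equiv.Perm.mul_apply,
      Equiv.Perm.mul_apply] at key
    rw [permBruhatLT_mul_swap_iff _ ha.symm]
    tauto
  · intro h w i hw a ha
    exact h w _ (cs.isReflection_simple i)
      (.single ⟨_, cs.isReflection_simple i, rfl, by lia⟩) a ha
end

section
/- Let (W,S) be the Coxeter system of type E₈, with simple reflections s₁, …, s₈ indexed by the standard E₈ Coxeter matrix, and let c = s₁s₂s₃s₄s₅s₆s₇s₈ be the corresponding Coxeter element. Then ℓ(c¹⁵) = 120 (so the concatenation of fifteen copies of the word s₁s₂⋯s₈ is a reduced word), and c¹⁵ is the longest element of W, i.e., ℓ(w) ≤ 120 for all w ∈ W. -/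
open Matrix

namespace CoxeterE8

/-- The pairing of a vector of the root lattice, in simple-root coordinates, with a simple root. -/
def pairing (v : Fin 8 → ℤ) (i : Fin 8) : ℤ := (CartanMatrix.E₈ *ᵥ v) i

/-- The simple roots. -/
abbrev simpleRoot (i : Fin 8) : Fin 8 → ℤ := Pi.single i 1

/-- The squared norm on the root lattice; roots have squared norm `2`. -/
def normSq (v : Fin 8 → ℤ) : ℤ := v ⬝ᵥ CartanMatrix.E₈ *ᵥ v

/-- Positive roots: the lattice vectors of squared norm `2` with nonnegative coordinates. -/
def IsPosRoot (v : Fin 8 → ℤ) : Prop := (∀ k, 0 ≤ v k) ∧ normSq v = 2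

/-- The height of a lattice vector. -/
def height (v : Fin 8 → ℤ) : ℤ := ∑ k, v k

lemma pairing_sub (v w : Fin 8 → ℤ) (i : Fin 8) :
    pairing (v - w) i = pairing v i - pairing w i := by
  simp [pairing, mulVec_sub]

lemma pairing_add (v w : Fin 8 → ℤ) (i : Fin 8) :
    pairing (v + w) i = pairing v i + pairing w i := by
  simp [pairing, mulVec_add]

lemma pairing_single (j : Fin 8) (c : ℤ) (i : Fin 8) :
    pairing (Pi.single j c) i = CartanMatrix.E₈ i j * c := by
  simp [pairing]

lemma normSq_eq (v : Fin 8 → ℤ) : normSq v = ∑ k, v k * pairing v k := rfl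

lemma normSq_add_single (v : Fin 8 → ℤ) (i : Fin 8) (c : ℤ) :
    normSq (v + Pi.single i c) = normSq v + 2 * c * pairing v i + 2 * c ^ 2 := by
  have h : v ⬝ᵥ CartanMatrix.E₈ *ᵥ Pi.single i c = c * pairing v i := by
    rw [dotProduct_mulVec, ← mulVec_transpose, CartanMatrix.E₈_transpose, dotProduct_single]
    exact mul_comm _ _
  have h' : Pi.single i c ⬝ᵥ CartanMatrix.E₈ *ᵥ v = c * pairing v i := single_dotProduct _ _ _
  have h'' : Pi.single i c ⬝ᵥ CartanMatrix.E₈ *ᵥ Pi.single i c = 2 * c ^ 2 := by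
    rw [single_dotProduct]
    simp
    ring
  unfold normSq
  rw [mulVec_add, add_dotProduct, dotProduct_add, dotProduct_add, h, h', h'']
  ring

lemma sixty_mul_normSq (v : Fin 8 → ℤ) :
    60 * normSq v = 30 * (2 * v 0 - v 2) ^ 2 + 10 * (3 * v 2 - 2 * v 3) ^ 2 +
      30 * (2 * v 1 - v 3) ^ 2 + 30 * (2 * v 7 - v 6) ^ 2 + 10 * (3 * v 6 - 2 * v 5) ^ 2 +
      5 * (4 * v 5 - 3 * v 4) ^ 2 + 3 * (5 * v 4 - 4 * v 3) ^ 2 + 2 * v 3 ^ 2 := by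
  simp [normSq, CartanMatrix.E₈, mulVec, dotProduct, Fin.sum_univ_eight]
  ring

lemma normSq_nonneg (v : Fin 8 → ℤ) : 0 ≤ normSq v := by
  have h := sixty_mul_normSq v
  have : 0 ≤ 60 * normSq v := by rw [h]; positivity
  lia

lemma eq_zero_of_normSq_eq_zero {v : Fin 8 → ℤ} (hv : normSq v = 0) : v = 0 := by
  have h := sixty_mul_normSq v
  rw [hv] at h
  have h3 : v 3 = 0 := pow_eq_zero_iff two_ne_zero |>.1 (by nlinarith)
  have h2 : 3 * v 2 - 2 * v 3 = 0 := pow_eq_zero_iff two_ne_zero |>.1 (by nlinarith)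
  have h0 : 2 * v 0 - v 2 = 0 := pow_eq_zero_iff two_ne_zero |>.1 (by nlinarith)
  have h1 : 2 * v 1 - v 3 = 0 := pow_eq_zero_iff two_ne_zero |>.1 (by nlinarith)
  have h4 : 5 * v 4 - 4 * v 3 = 0 := pow_eq_zero_iff two_ne_zero |>.1 (by nlinarith)
  have h5 : 4 * v 5 - 3 * v 4 = 0 := pow_eq_zero_iff two_ne_zero |>.1 (by nlinarith)
  have h6 : 3 * v 6 - 2 * v 5 = 0 := pow_eq_zero_iff two_ne_zero |>.1 (by nlinarith)
  have h7 : 2 * v 7 - v 6 = 0 := pow_eq_zero_iff two_ne_zero |>.1 (by nlinarith)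
  ext k
  fin_cases k <;> simp <;> lia

lemma cartan_cases (i j : Fin 8) : i = j ∨
    (CoxeterMatrix.E₈ i j = 2 ∧ CartanMatrix.E₈ i j = 0 ∧ CartanMatrix.E₈ j i = 0) ∨
    (CoxeterMatrix.E₈ i j = 3 ∧ CartanMatrix.E₈ i j = -1 ∧ CartanMatrix.E₈ j i = -1) := by
  fin_cases i <;> fin_cases j <;> simp [CoxeterMatrix.E₈, CartanMatrix.E₈]

lemma pairing_simpleRoot_self (i : Fin 8) : pairing (simpleRoot i) i = 2 := by
  simp [pairing_single]

lemma height_simpleRoot (i : Fin 8) : height (simpleRoot i) = 1 := by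
  simp [height]

lemma height_sub_simpleRoot (v : Fin 8 → ℤ) (i : Fin 8) :
    height (v - simpleRoot i) = height v - 1 := by
  rw [← height_simpleRoot i]
  simp only [height, Pi.sub_apply, Finset.sum_sub_distrib]

lemma isPosRoot_simpleRoot (i : Fin 8) : IsPosRoot (simpleRoot i) := by
  refine ⟨fun k ↦ ?_, ?_⟩
  · by_cases h : k = i <;> simp [h]
  · simp [normSq]

lemma IsPosRoot.height_pos {v : Fin 8 → ℤ} (hv : IsPosRoot v) : 0 < height v := by
  refine (Finset.sum_nonneg fun k _ ↦ hv.1 k).lt_of_ne fun h ↦ ?_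
  have := (Finset.sum_eq_zero_iff_of_nonneg fun k _ ↦ hv.1 k).1 h.symm
  have h2 := hv.2
  simp [normSq_eq, this] at h2

lemma not_isPosRoot_neg {v : Fin 8 → ℤ} (hv : IsPosRoot v) : ¬ IsPosRoot (-v) := fun h ↦ by
  have h1 := hv.height_pos
  have h2 := h.height_pos
  simp only [height, Pi.neg_apply, Finset.sum_neg_distrib] at h1 h2
  lia

lemma IsPosRoot.pairing_le {v : Fin 8 → ℤ} (hv : IsPosRoot v) {i : Fin 8}
    (hi : v ≠ simpleRoot i) : pairing v i ≤ 1 := by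
  by_contra! h
  have h1 := normSq_add_single v i (-1)
  have h2 := normSq_nonneg (v + Pi.single i (-1))
  have h3 := eq_zero_of_normSq_eq_zero (v := v + Pi.single i (-1)) (by linarith [hv.2])
  apply hi
  rw [eq_neg_of_add_eq_zero_left h3, ← Pi.single_neg, neg_neg]

lemma IsPosRoot.neg_one_le_pairing {v : Fin 8 → ℤ} (hv : IsPosRoot v) (i : Fin 8) :
    -1 ≤ pairing v i := by
  by_contra! h
  have h1 := normSq_add_single v i 1
  have h2 := normSq_nonneg (v + Pi.single i 1)
  have h3 := eq_zero_of_normSq_eq_zero (v := v + Pi.single i 1) (by linarith [hv.2])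
  have h4 := congrFun h3 i
  have := hv.1 i
  simp at h4
  lia

lemma pairing_nonpos_of_apply_eq_zero {v : Fin 8 → ℤ} (hv : ∀ k, 0 ≤ v k) {i : Fin 8}
    (hi : v i = 0) : pairing v i ≤ 0 := by
  change ∑ k, CartanMatrix.E₈ i k * v k ≤ 0
  refine Finset.sum_nonpos fun k _ ↦ ?_
  by_cases h : i = k
  · simp [← h, hi]
  · exact mul_nonpos_of_nonpos_of_nonneg (CartanMatrix.E₈_off_diag_nonpos i k h) (hv k)

lemma IsPosRoot.reflect {v : Fin 8 → ℤ} (hv : IsPosRoot v) {i : Fin 8}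
    (hi : v ≠ simpleRoot i) : IsPosRoot (v - Pi.single i (pairing v i)) := by
  refine ⟨fun k ↦ ?_, ?_⟩
  · rcases eq_or_ne k i with rfl | h
    · have h1 := hv.pairing_le hi
      have h2 := hv.1 k
      have h3 := pairing_nonpos_of_apply_eq_zero hv.1 (i := k)
      simp only [Pi.sub_apply, Pi.single_eq_same]
      lia
    · simpa [h] using hv.1 k
  · rw [sub_eq_add_neg, ← Pi.single_neg, normSq_add_single, hv.2]
    ring

lemma IsPosRoot.sub_simpleRoot {v : Fin 8 → ℤ} (hv : IsPosRoot v) {i : Fin 8}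
    (hi : pairing v i = 1) : IsPosRoot (v - simpleRoot i) := by
  have h := hv.reflect (i := i) (by rintro rfl; simp [pairing_single] at hi)
  rwa [hi] at h

lemma IsPosRoot.add_simpleRoot {v : Fin 8 → ℤ} (hv : IsPosRoot v) {i : Fin 8}
    (hi : pairing v i = -1) : IsPosRoot (v + simpleRoot i) := by
  have h := hv.reflect (i := i) (by rintro rfl; simp [pairing_single] at hi)
  rwa [hi, Pi.single_neg, sub_neg_eq_add] at h

lemma IsPosRoot.eq_simpleRoot_or_exists {v : Fin 8 → ℤ} (hv : IsPosRoot v) :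
    (∃ i, v = simpleRoot i) ∨ ∃ i, pairing v i = 1 := by
  by_contra! h
  have : normSq v ≤ 0 := by
    rw [normSq_eq]
    refine Finset.sum_nonpos fun k _ ↦ mul_nonpos_of_nonneg_of_nonpos (hv.1 k) ?_
    have h1 := hv.pairing_le (h.1 k)
    have h2 := h.2 k
    lia
  linarith [hv.2]

/-! ### Enumeration of the positive roots -/

/-- The decimal digits of `n` as a lattice vector, most significant first. -/
def digits (n : ℕ) (k : Fin 8) : ℤ := (n / 10 ^ (7 - k : ℕ) % 10 : ℕ)

/-- The positive roots, each written as a string of eight decimal coordinates. -/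
def posRootCodes : List ℕ := [
  10000000, 01000000, 00100000, 00010000, 00001000, 00000100, 00000010, 00000001, 10100000,
  01010000, 00110000, 00011000, 00001100, 00000110, 00000011, 10110000, 01110000, 01011000,
  00111000, 00011100, 00001110, 00000111, 11110000, 10111000, 01111000, 01011100, 00111100,
  00011110, 00001111, 11111000, 10111100, 01121000, 01111100, 01011110, 00111110, 00011111,
  11121000, 11111100, 10111110, 01121100, 01111110, 01011111, 00111111, 11221000, 11121100,
  11111110, 10111111, 01122100, 01121110, 01111111, 11221100, 11122100, 11121110, 11111111,
  01122110, 01121111, 11222100, 11221110, 11122110, 11121111, 01122210, 01122111, 11232100,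
  11222110, 11221111, 11122210, 11122111, 01122211, 12232100, 11232110, 11222210, 11222111,
  11122211, 01122221, 12232110, 11232210, 11232111, 11222211, 11122221, 12232210, 12232111,
  11233210, 11232211, 11222221, 12233210, 12232211, 11233211, 11232221, 12243210, 12233211,
  12232221, 11233221, 12343210, 12243211, 12233221, 11233321, 22343210, 12343211, 12243221,
  12233321, 22343211, 12343221, 12243321, 22343221, 12343321, 12244321, 22343321, 12344321,
  22344321, 12354321, 22354321, 13354321, 23354321, 22454321, 23454321, 23464321, 23465321,
  23465421, 23465431, 23465432]

/-- The finite set of positive roots. -/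
def posRoots : Finset (Fin 8 → ℤ) := (posRootCodes.map digits).toFinset

lemma mem_posRoots {v : Fin 8 → ℤ} : v ∈ posRoots ↔ ∃ n ∈ posRootCodes, digits n = v := by
  simp [posRoots]

lemma card_posRoots : posRoots.card = 120 := by
  have h : ∀ n ∈ posRootCodes,
      ((∑ k : Fin 8, digits n k * 10 ^ (7 - k : ℕ) : ℤ)).toNat = n := by
    decide +kernel
  have hn : posRootCodes.Nodup := by decide +kernel
  rw [posRoots, List.toFinset_card_of_nodup]
  · rfl
  · refine hn.map_on fun m hm n hn hmn ↦ ?_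
    rw [← h m hm, ← h n hn, hmn]

lemma mem_posRoots_iff {v : Fin 8 → ℤ} : v ∈ posRoots ↔ IsPosRoot v := by
  constructor
  · have h : ∀ n ∈ posRootCodes, (∀ k, 0 ≤ digits n k) ∧ normSq (digits n) = 2 := by
      decide +kernel
    intro hv
    obtain ⟨n, hn, rfl⟩ := mem_posRoots.1 hv
    exact h n hn
  · have hsimple : ∀ i, simpleRoot i ∈ posRoots := by
      simp only [mem_posRoots]
      decide +kernel
    have hadd : ∀ n ∈ posRootCodes, ∀ i, pairing (digits n) i = -1 →
        n + 10 ^ (7 - i : ℕ) ∈ posRootCodes ∧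
          digits (n + 10 ^ (7 - i : ℕ)) = digits n + simpleRoot i := by
      decide +kernel
    intro hv
    induction hm : (height v).toNat generalizing v with
    | zero =>
      have := hv.height_pos
      lia
    | succ m ih =>
      obtain ⟨i, rfl⟩ | ⟨i, hi⟩ := hv.eq_simpleRoot_or_exists
      · exact hsimple i
      · have hmem := ih (hv.sub_simpleRoot hi) (by rw [height_sub_simpleRoot]; lia)
        obtain ⟨n, hn, hnv⟩ := mem_posRoots.1 hmem
        have h := hadd n hn i (by rw [hnv, pairing_sub, pairing_simpleRoot_self, hi]; rfl)
        rw [hnv, sub_add_cancel] at h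
        exact mem_posRoots.2 ⟨_, h⟩

/-! ### The reflection representation -/

/-- The simple reflections acting on the root lattice. -/
def reflection (i : Fin 8) : Module.End ℤ (Fin 8 → ℤ) :=
  1 - LinearMap.single ℤ (fun _ ↦ ℤ) i ∘ₗ LinearMap.proj i ∘ₗ mulVecLin CartanMatrix.E₈

lemma reflection_apply (i : Fin 8) (v : Fin 8 → ℤ) :
    reflection i v = v - Pi.single i (pairing v i) := rfl

lemma reflection_mul_self (i : Fin 8) : reflection i * reflection i = 1 := by
  refine LinearMap.ext fun v ↦ funext fun k ↦ ?_
  simp only [Module.End.mul_apply, Module.End.one_apply, reflection_apply, pairing_sub,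
    pairing_single, CartanMatrix.E₈_diag, Pi.sub_apply, Pi.single_apply]
  split_ifs <;> ring

lemma reflection_mul_comm {i j : Fin 8} (hij : CartanMatrix.E₈ i j = 0)
    (hji : CartanMatrix.E₈ j i = 0) :
    reflection i * reflection j = reflection j * reflection i := by
  refine LinearMap.ext fun v ↦ funext fun k ↦ ?_
  simp only [Module.End.mul_apply, reflection_apply, pairing_sub,
    pairing_single, hij, hji, Pi.sub_apply, Pi.single_apply]
  split_ifs <;> ring

lemma reflection_braid {i j : Fin 8} (hij : CartanMatrix.E₈ i j = -1)
    (hji : CartanMatrix.E₈ j i = -1) :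
    reflection i * reflection j * reflection i = reflection j * reflection i * reflection j := by
  refine LinearMap.ext fun v ↦ funext fun k ↦ ?_
  simp only [Module.End.mul_apply, reflection_apply, pairing_sub,
    pairing_single, hij, hji, CartanMatrix.E₈_diag, Pi.sub_apply, Pi.single_apply]
  split_ifs <;> ring

lemma isLiftable_reflection : CoxeterMatrix.E₈.IsLiftable reflection := by
  intro i j
  obtain rfl | ⟨hM, hij, hji⟩ | ⟨hM, hij, hji⟩ := cartan_cases i j
  · rw [CoxeterMatrix.diagonal, pow_one, reflection_mul_self]
  · rw [hM, pow_two]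
    nth_rw 2 [reflection_mul_comm hij hji]
    rw [mul_assoc, ← mul_assoc (reflection j), reflection_mul_self, one_mul, reflection_mul_self]
  · rw [hM]
    calc (reflection i * reflection j) ^ 3
        = (reflection i * reflection j * reflection i) *
            (reflection j * reflection i * reflection j) := by
          simp only [pow_succ, pow_zero, one_mul, mul_assoc]
      _ = reflection i * (reflection j * (reflection i * reflection i) * reflection j) *
            reflection i := by
          rw [← reflection_braid hij hji]
          simp only [mul_assoc]
      _ = 1 := by simp only [reflection_mul_self, mul_one]

/-- The matrix of the Coxeter element in the basis of simple roots. -/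
def coxeterElementMatrix : Matrix (Fin 8) (Fin 8) ℤ :=
  !![0, 1, 0, 0, 0, 0, 0, -1;
     0, 0, 1, 0, 0, 0, 0, -1;
     1, 1, 0, 0, 0, 0, 0, -1;
     0, 1, 1, 0, 0, 0, 0, -1;
     0, 0, 0, 1, 0, 0, 0, -1;
     0, 0, 0, 0, 1, 0, 0, -1;
     0, 0, 0, 0, 0, 1, 0, -1;
     0, 0, 0, 0, 0, 0, 1, -1]

lemma coxeterElementMatrix_pow_five : coxeterElementMatrix ^ 5 =
    !![1, 1, 1, -1, 0, 0, -1, 0;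
     1, 2, 1, -1, 0, -1, 0, -1;
     1, 2, 2, -1, -1, 0, -1, -1;
     2, 3, 2, -1, -1, -1, -1, -1;
     1, 2, 2, -1, 0, -1, -1, -1;
     1, 2, 1, -1, 0, 0, -1, -1;
     1, 1, 1, -1, 0, 0, 0, -1;
     0, 1, 1, -1, 0, 0, 0, 0] := by
  decide +kernel

lemma coxeterElementMatrix_pow : coxeterElementMatrix ^ 15 = -1 := by
  rw [show 15 = 5 * 3 from rfl, pow_mul, coxeterElementMatrix_pow_five]
  decide +kernel

lemma prod_reflection : (List.ofFn reflection).prod = toLin' coxeterElementMatrix := by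
  refine LinearMap.pi_ext' fun j ↦ LinearMap.ext_ring (funext fun k ↦ ?_)
  simp only [LinearMap.comp_apply, LinearMap.single_apply, toLin'_apply, mulVec_single_one, col_apply,
    List.ofFn_succ, List.ofFn_zero, List.prod_cons, List.prod_nil, mul_one, Module.End.mul_apply]
  revert j k
  decide +kernel

lemma prod_reflection_pow : (List.ofFn reflection).prod ^ 15 = -1 := by
  rw [prod_reflection, ← toLin'_pow, coxeterElementMatrix_pow, map_neg, toLin'_one]
  rfl

section Group

variable {W : Type*} [Group W] (cs : CoxeterSystem CoxeterMatrix.E₈ W)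

/-- The reflection representation of a Coxeter group of type `E₈` on the root lattice. -/
def rootRep : W →* Module.End ℤ (Fin 8 → ℤ) := cs.lift ⟨reflection, isLiftable_reflection⟩

lemma rootRep_simple (i : Fin 8) : rootRep cs (cs.simple i) = reflection i :=
  cs.lift_apply_simple isLiftable_reflection i

lemma rootRep_injective (w : W) : Function.Injective (rootRep cs w) := by
  refine Function.LeftInverse.injective (g := rootRep cs w⁻¹) fun v ↦ ?_
  rw [← Module.End.mul_apply, ← map_mul, inv_mul_cancel, map_one, Module.End.one_apply]

/-- The number of positive roots sent to non-positive ones is at most the length of a word. -/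
lemma card_inversions_wordProd_le (ω : List (Fin 8)) :
    {v ∈ posRoots | rootRep cs (cs.wordProd ω) v ∉ posRoots}.card ≤ ω.length := by
  induction ω with
  | nil => simp
  | cons i ω ih =>
    have hsub : {v ∈ posRoots | rootRep cs (cs.wordProd (i :: ω)) v ∉ posRoots} ⊆
        {v ∈ posRoots | rootRep cs (cs.wordProd ω) v ∉ posRoots} ∪
          {v ∈ posRoots | rootRep cs (cs.wordProd ω) v = simpleRoot i} := by
      intro v
      simp only [Finset.mem_union, Finset.mem_filter, cs.wordProd_cons, map_mul, rootRep_simple,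
        Module.End.mul_apply, reflection_apply, mem_posRoots_iff]
      rintro ⟨hv, h⟩
      by_contra! h'
      exact h ((h'.1 hv).reflect (h'.2 hv))
    have hone : {v ∈ posRoots | rootRep cs (cs.wordProd ω) v = simpleRoot i}.card ≤ 1 := by
      refine Finset.card_le_one.2 fun v hv w hw ↦ rootRep_injective cs (cs.wordProd ω) ?_
      rw [(Finset.mem_filter.1 hv).2, (Finset.mem_filter.1 hw).2]
    exact (Finset.card_le_card hsub).trans <|
      (Finset.card_union_le _ _).trans (Nat.add_le_add ih hone)

lemma card_inversions_le_length (w : W) :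
    {v ∈ posRoots | rootRep cs w v ∉ posRoots}.card ≤ cs.length w := by
  obtain ⟨ω, hω, rfl⟩ := cs.exists_isReduced w
  exact (card_inversions_wordProd_le cs ω).trans_eq hω.eq.symm

lemma le_length_coxeterElement_pow :
    120 ≤ cs.length ((List.ofFn cs.simple).prod ^ 15) := by
  have hc : rootRep cs ((List.ofFn cs.simple).prod ^ 15) = -1 := by
    rw [map_pow, map_list_prod, List.map_ofFn]
    exact (congrArg (fun f ↦ (List.ofFn f).prod ^ 15)
      (funext fun i ↦ rootRep_simple cs i)).trans prod_reflection_pow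
  rw [← card_posRoots]
  refine le_trans (Finset.card_le_card fun v hv ↦ ?_) (card_inversions_le_length cs _)
  rw [Finset.mem_filter, hc]
  exact ⟨hv, fun h ↦ not_isPosRoot_neg (mem_posRoots_iff.1 hv) (mem_posRoots_iff.1 h)⟩

/-! ### Reflections are indexed by positive roots -/

lemma simple_mul_comm {i j : Fin 8} (hM : CoxeterMatrix.E₈ i j = 2) :
    cs.simple i * cs.simple j = cs.simple j * cs.simple i := by
  have h := cs.simple_mul_simple_pow i j
  rw [hM, pow_two] at h
  simpa using eq_inv_of_mul_eq_one_left h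

lemma simple_braid {i j : Fin 8} (hM : CoxeterMatrix.E₈ i j = 3) :
    cs.simple i * cs.simple j * cs.simple i = cs.simple j * cs.simple i * cs.simple j := by
  have h := cs.simple_mul_simple_pow i j
  have h' : (cs.simple i * cs.simple j * cs.simple i) *
      (cs.simple j * cs.simple i * cs.simple j) = 1 := by
    rw [← h, hM]
    simp only [pow_succ, pow_zero, one_mul, mul_assoc]
  simpa [mul_assoc] using eq_inv_of_mul_eq_one_left h'

open Classical in
/-- The reflection of `W` along a positive root, computed by recursion on the height `n`. -/
noncomputable def rootReflectionAux : ℕ → (Fin 8 → ℤ) → W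
  | 0, _ => 1
  | n + 1, v =>
    if h : ∃ i, v = simpleRoot i then cs.simple h.choose
    else if h : ∃ i, pairing v i = 1 then
      cs.simple h.choose * rootReflectionAux n (v - simpleRoot h.choose) * cs.simple h.choose
    else 1

/-- The reflection of `W` along a positive root. -/
noncomputable def rootReflection (v : Fin 8 → ℤ) : W := rootReflectionAux cs (height v).toNat v

lemma rootReflection_simpleRoot (i : Fin 8) : rootReflection cs (simpleRoot i) = cs.simple i := by
  have h : ∃ j, simpleRoot i = simpleRoot j := ⟨i, rfl⟩
  have hi : h.choose = i := by
    by_contra hne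
    simpa [Ne.symm hne] using congrFun h.choose_spec i
  rw [rootReflection, height_simpleRoot]
  change rootReflectionAux cs (0 + 1) _ = _
  rw [rootReflectionAux, dif_pos h, hi]

lemma IsPosRoot.exists_rootReflection_eq {v : Fin 8 → ℤ} (hv : IsPosRoot v)
    (hs : ¬ ∃ i, v = simpleRoot i) : ∃ i, pairing v i = 1 ∧
      rootReflection cs v =
        cs.simple i * rootReflection cs (v - simpleRoot i) * cs.simple i := by
  have h := hv.eq_simpleRoot_or_exists.resolve_left hs
  refine ⟨h.choose, h.choose_spec, ?_⟩
  obtain ⟨n, hn⟩ : ∃ n, (height v).toNat = n + 1 :=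
    Nat.exists_eq_succ_of_ne_zero (by have := hv.height_pos; lia)
  have hn' : (height (v - simpleRoot h.choose)).toNat = n := by
    rw [height_sub_simpleRoot]
    lia
  rw [rootReflection, rootReflection, hn, hn', rootReflectionAux, dif_neg hs, dif_pos h]

lemma rootReflection_spec {v : Fin 8 → ℤ} (hv : IsPosRoot v) :
    (∀ i, pairing v i = 1 → rootReflection cs v =
      cs.simple i * rootReflection cs (v - simpleRoot i) * cs.simple i) ∧
    ∀ i, pairing v i = 0 → Commute (cs.simple i) (rootReflection cs v) := by
  induction hm : (height v).toNat using Nat.strong_induction_on generalizing v with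
  | _ m ih =>
  have hpos := hv.height_pos
  have ih' {u : Fin 8 → ℤ} (hu : IsPosRoot u) (hlt : height u < height v) :=
    ih _ (by lia) hu rfl
  have hlt (k : Fin 8) : height (v - simpleRoot k) < height v := by
    rw [height_sub_simpleRoot]
    lia
  have hlt' (k i : Fin 8) : height (v - simpleRoot k - simpleRoot i) < height v := by
    rw [height_sub_simpleRoot, height_sub_simpleRoot]
    lia
  by_cases hs : ∃ k, v = simpleRoot k
  · obtain ⟨k, rfl⟩ := hs
    simp only [pairing_single, mul_one, rootReflection_simpleRoot]
    constructor <;> intro i hi <;> obtain rfl | ⟨hM, hik, -⟩ | ⟨-, hik, -⟩ := cartan_cases i k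
    · simp at hi
    · lia
    · lia
    · simp at hi
    · exact simple_mul_comm cs hM
    · lia
  obtain ⟨k, hk, hvk⟩ := hv.exists_rootReflection_eq cs hs
  have hγ := hv.sub_simpleRoot hk
  constructor
  · intro i hi
    have hγ' := hv.sub_simpleRoot hi
    obtain rfl | ⟨hM, hik, hki⟩ | ⟨hM, hik, hki⟩ := cartan_cases i k
    · exact hvk
    · have h1 := (ih' hγ (hlt k)).1 i (by simp [pairing_sub, pairing_single, hi, hik])
      have h2 := (ih' hγ' (hlt i)).1 k (by simp [pairing_sub, pairing_single, hk, hki])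
      have hc := simple_mul_comm cs hM
      rw [hvk, h1, h2, sub_right_comm]
      simp only [← mul_assoc]
      rw [hc, mul_assoc _ (cs.simple i), mul_assoc _ (cs.simple k), hc]
    · have h1 : v - simpleRoot k = simpleRoot i := by
        by_contra h
        have := hγ.pairing_le h
        rw [pairing_sub, pairing_single, hi, hik] at this
        lia
      have h2 : v - simpleRoot i = simpleRoot k := by rw [← h1, sub_sub_cancel]
      rw [hvk, h1, h2, rootReflection_simpleRoot, rootReflection_simpleRoot, simple_braid cs hM]
  · intro i hi
    obtain rfl | ⟨hM, hik, hki⟩ | ⟨hM, hik, hki⟩ := cartan_cases i k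
    · lia
    · have h1 := (ih' hγ (hlt k)).2 i (by simp [pairing_sub, pairing_single, hi, hik])
      have hc : Commute (cs.simple i) (cs.simple k) := simple_mul_comm cs hM
      rw [hvk]
      exact (hc.mul_right h1).mul_right hc
    · have hi' : pairing (v - simpleRoot k) i = 1 := by
        simp [pairing_sub, pairing_single, hi, hik]
      have h1 := (ih' hγ (hlt k)).1 i hi'
      have h2 := (ih' (hγ.sub_simpleRoot hi') (hlt' k i)).2 k
        (by simp [pairing_sub, pairing_single, hk, hki])
      have hb := simple_braid cs hM
      rw [hvk, h1]
      generalize rootReflection cs (v - simpleRoot k - simpleRoot i) = t at h2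
      generalize cs.simple i = a at *
      generalize cs.simple k = b at *
      calc a * (b * (a * t * a) * b)
          = (a * b * a) * t * a * b := by simp only [mul_assoc]
        _ = b * a * (b * t) * a * b := by rw [hb]; simp only [mul_assoc]
        _ = b * a * t * (b * a * b) := by rw [h2.eq]; simp only [mul_assoc]
        _ = b * (a * t * a) * b * a := by rw [← hb]; simp only [mul_assoc]

lemma exists_rootReflection_eq_conj {v : Fin 8 → ℤ} (hv : IsPosRoot v) (i : Fin 8) :
    ∃ u, IsPosRoot u ∧
      rootReflection cs u = cs.simple i * rootReflection cs v * cs.simple i := by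
  by_cases hs : v = simpleRoot i
  · exact ⟨v, hv, by simp [hs, rootReflection_simpleRoot]⟩
  have h1 := hv.pairing_le hs
  have h2 := hv.neg_one_le_pairing i
  obtain h | h | h : pairing v i = -1 ∨ pairing v i = 0 ∨ pairing v i = 1 := by lia
  · refine ⟨_, hv.add_simpleRoot h, ?_⟩
    rw [(rootReflection_spec cs (hv.add_simpleRoot h)).1 i
      (by simp [pairing_add, pairing_single, h]), add_sub_cancel_right]
  · refine ⟨v, hv, ?_⟩
    rw [((rootReflection_spec cs hv).2 i h).eq, cs.simple_mul_simple_cancel_right]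
  · refine ⟨_, hv.sub_simpleRoot h, ?_⟩
    simp [(rootReflection_spec cs hv).1 i h, mul_assoc]

lemma exists_rootReflection_eq_of_isReflection {t : W} (ht : cs.IsReflection t) :
    ∃ v, IsPosRoot v ∧ rootReflection cs v = t := by
  obtain ⟨w, i, rfl⟩ := ht
  induction w using cs.simple_induction_left with
  | one => exact ⟨_, isPosRoot_simpleRoot i, by simp [rootReflection_simpleRoot]⟩
  | mul_simple_left w j ih =>
    obtain ⟨v, hv, hvt⟩ := ih
    obtain ⟨u, hu, hut⟩ := exists_rootReflection_eq_conj cs hv j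
    exact ⟨u, hu, by simp [hut, hvt, mul_assoc]⟩

lemma length_le (w : W) : cs.length w ≤ 120 := by
  classical
  obtain ⟨ω, hω, rfl⟩ := cs.exists_isReduced w
  rw [hω.eq, ← cs.length_leftInvSeq, ← List.toFinset_card_of_nodup hω.nodup_leftInvSeq,
    ← card_posRoots]
  refine (Finset.card_le_card fun t ht ↦ ?_).trans
    (Finset.card_image_le (f := rootReflection cs))
  obtain ⟨v, hv, rfl⟩ := exists_rootReflection_eq_of_isReflection cs
    (cs.isReflection_of_mem_leftInvSeq ω (List.mem_toFinset.1 ht))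
  exact Finset.mem_image_of_mem _ (mem_posRoots_iff.2 hv)

end Group

end CoxeterE8

theorem stmt10 {W : Type*} [Group W] (cs : CoxeterSystem CoxeterMatrix.E₈ W) :
    cs.length ((List.ofFn cs.simple).prod ^ 15) = 120 ∧
      ∀ w : W, cs.length w ≤ 120 :=
  ⟨(CoxeterE8.length_le cs _).antisymm (CoxeterE8.le_length_coxeterElement_pow cs),
    CoxeterE8.length_le cs⟩
end
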